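/- (Ellipsoidal certified region for anisotropic Gaussian smoothing) Let f : ℝ^d → 𝒴 be any deterministic function into a finite set of classes 𝒴, let μ ∈ ℝ^d and σ₁,…,σ_d > 0, and let ε be a random vector whose i-th coordinate is an independent Gaussian N(μ_i, σ_i²). Suppose that for a specific x ∈ ℝ^d there exist a class c_A ∈ 𝒴 and reals p_A, p_B ∈ [0,1] such that P(f(x+ε)=c_A) ≥ p_A ≥ p_B ≥ max_{c ≠ c_A} P(f(x+ε)=c). Then for every δ ∈ ℝ^d satisfying √(Σ_{i=1}^d δ_i²/σ_i²) ≤ (1/2)·(Φ⁻¹(p_A) − Φ⁻¹(p_B)), one has P(f(x+δ+ε)=c_A) ≥ P(f(x+δ+ε)=c) for all c ≠ c_A. -/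

import Mathlib

open MeasureTheory ProbabilityTheory

/-- The cumulative distribution function of the standard normal distribution `N(0,1)`. -/
noncomputable def Phi : ℝ → ℝ :=
  fun x => ((gaussianReal 0 1) (Set.Iic x)).toReal

/-- The inverse of the standard normal CDF. -/
noncomputable def PhiInv : ℝ → ℝ := Function.invFun Phi

lemma Phi_eq_cdf : Phi = cdf (gaussianReal 0 1) := by
  ext x
  rw [cdf_eq_real]; rfl

lemma Phi_mono : Monotone Phi := by
  rw [Phi_eq_cdf]; exact monotone_cdf _

lemma noAtoms_std : NullSingletonClass (gaussianReal 0 1) :=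
  nullSingletonClass_gaussianReal one_ne_zero

lemma Phi_continuous : Continuous Phi := by
  rw [Phi_eq_cdf, continuous_iff_continuousAt]
  intro x
  rw [(monotone_cdf _).continuousAt_iff_leftLim_eq_rightLim]
  have h1 := (cdf (gaussianReal 0 1)).measure_singleton x
  rw [measure_cdf] at h1
  have := noAtoms_std
  rw [measure_singleton] at h1
  have h2 := ENNReal.ofReal_eq_zero.1 h1.symm
  have h3 := (monotone_cdf (gaussianReal 0 1)).leftLim_le (le_refl x)
  rw [(cdf (gaussianReal 0 1)).rightLim_eq]
  linarith

lemma Phi_PhiInv {p : ℝ} (h0 : 0 < p) (h1 : p < 1) : Phi (PhiInv p) = p := by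
  apply Function.invFun_eq
  apply mem_range_of_exists_le_of_exists_ge Phi_continuous
  · have := (tendsto_cdf_atBot (gaussianReal 0 1)).eventually (Iio_mem_nhds h0)
    obtain ⟨a, ha⟩ := this.exists
    exact ⟨a, by rw [Phi_eq_cdf]; exact ha.le⟩
  · have := (tendsto_cdf_atTop (gaussianReal 0 1)).eventually (Ioi_mem_nhds h1)
    obtain ⟨a, ha⟩ := this.exists
    exact ⟨a, by rw [Phi_eq_cdf]; exact ha.le⟩

lemma Phi_neg (x : ℝ) : Phi (-x) = 1 - Phi x := by
  have := noAtoms_std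
  have h : (gaussianReal 0 1).map (fun x => -x) = gaussianReal 0 1 := by
    simpa using gaussianReal_map_neg (μ := 0) (v := 1)
  have h2 : gaussianReal 0 1 (Set.Iic (-x)) = gaussianReal 0 1 (Set.Iic x)ᶜ := by
    conv_lhs => rw [← h]
    rw [Measure.map_apply (by fun_prop) measurableSet_Iic, Set.compl_Iic,
      measure_congr Ioi_ae_eq_Ici]
    congr 1
    ext y; simp
  unfold Phi
  rw [h2]
  exact probReal_compl_eq_one_sub measurableSet_Iic

lemma pi_withDensity' {d : ℕ} (P : Fin d → Measure ℝ) [∀ i, IsProbabilityMeasure (P i)]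
    (g : Fin d → ℝ → ENNReal) (hg : ∀ i, Measurable (g i))
    [∀ i, IsProbabilityMeasure ((P i).withDensity (g i))] :
    Measure.pi (fun i => (P i).withDensity (g i)) =
      (Measure.pi P).withDensity (fun e => ∏ i, g i (e i)) := by
  apply Measure.pi_eq
  intro s hs
  have hm : ∀ i, Measurable ((s i).indicator (g i)) := fun i => (hg i).indicator (hs i)
  rw [withDensity_apply _ (MeasurableSet.univ_pi hs), ← lintegral_indicator (MeasurableSet.univ_pi hs)]
  have h1 : (Set.univ.pi s).indicator (fun e : Fin d → ℝ => ∏ i, g i (e i)) =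
      fun e => ∏ i, (s i).indicator (g i) (e i) := by
    ext e
    by_cases he : e ∈ Set.univ.pi s
    · rw [Set.indicator_of_mem he]
      exact Finset.prod_congr rfl fun i _ => (Set.indicator_of_mem (he i trivial) _).symm
    · rw [Set.indicator_of_notMem he]
      simp only [Set.mem_univ_pi, not_forall] at he
      obtain ⟨i, hi⟩ := he
      exact (Finset.prod_eq_zero (Finset.mem_univ i) (Set.indicator_of_notMem hi _)).symm
  rw [h1, lintegral_prod_eq_prod_lintegral_of_indepFun Finset.univ
    (fun i (e : Fin d → ℝ) => (s i).indicator (g i) (e i))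
    (iIndepFun_pi (fun i => (hm i).aemeasurable))
    (fun i => (hm i).comp (measurable_pi_apply i))]
  refine Finset.prod_congr rfl fun i _ => ?_
  rw [withDensity_apply _ (hs i), ← lintegral_indicator (hs i)]
  exact (measurePreserving_eval P i).lintegral_comp (hm i)

lemma gaussian_shift (m a σ : ℝ) (hσ : 0 < σ) :
    gaussianReal (m + a) ((σ ^ 2).toNNReal) =
      (gaussianReal m ((σ ^ 2).toNNReal)).withDensity
        (fun e => ENNReal.ofReal (Real.exp (a * (e - m) / σ ^ 2 - a ^ 2 / σ ^ 2 / 2))) := by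
  have hv : (σ ^ 2).toNNReal ≠ 0 := by
    simp only [ne_eq, Real.toNNReal_eq_zero, not_le]; positivity
  rw [gaussianReal_of_var_ne_zero _ hv, gaussianReal_of_var_ne_zero _ hv,
    ← withDensity_mul _ (measurable_gaussianPDF _ _) (by fun_prop)]
  congr 1
  ext e
  simp only [gaussianPDF, gaussianPDFReal, Pi.mul_apply]
  rw [← ENNReal.ofReal_mul (by positivity),
    mul_assoc (√(2 * Real.pi * ((σ ^ 2).toNNReal : ℝ)))⁻¹, ← Real.exp_add,
    Real.coe_toNNReal _ (by positivity)]
  congr 3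
  field_simp
  ring

lemma law_Z {d : ℕ} (μ σ w : Fin d → ℝ)
    (hw : ∑ i, w i ^ 2 * σ i ^ 2 = 1) :
    (Measure.pi fun i : Fin d => gaussianReal (μ i) ((σ i ^ 2).toNNReal)).map
      (fun e => ∑ i, w i * (e i - μ i)) = gaussianReal 0 1 := by
  apply Measure.ext_of_charFun
  have hm : ∀ i, Measurable (fun y : ℝ => w i * (y - μ i)) := fun i => by fun_prop
  rw [iIndepFun.charFun_map_fun_sum_eq_prod
    (X := fun i (e : Fin d → ℝ) => w i * (e i - μ i))
    (fun i => ((hm i).comp (measurable_pi_apply i)).aemeasurable)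
    (iIndepFun_pi (X := fun i (y : ℝ) => w i * (y - μ i)) (fun i => (hm i).aemeasurable))]
  ext t
  have h : ∀ i, (Measure.pi fun i : Fin d => gaussianReal (μ i) ((σ i ^ 2).toNNReal)).map
      (fun e => w i * (e i - μ i)) =
      gaussianReal 0 (.mk (w i ^ 2) (sq_nonneg _) * (σ i ^ 2).toNNReal) := by
    intro i
    have e1 : (fun e : Fin d → ℝ => w i * (e i - μ i)) =
      (fun y => w i * y) ∘ (fun y => y - μ i) ∘ (Function.eval i) := rfl
    rw [e1, ← Measure.map_map (by fun_prop) (by fun_prop),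
      ← Measure.map_map (by fun_prop) (by fun_prop), (measurePreserving_eval _ i).map_eq,
      gaussianReal_map_sub_const, gaussianReal_map_const_mul]
    simp
  simp_rw [Finset.prod_apply, h, charFun_gaussianReal, ← Complex.exp_sum]
  congr 1
  have hw' : (∑ i, (w i : ℂ) ^ 2 * (σ i : ℂ) ^ 2) = 1 := by exact_mod_cast hw
  simp only [NNReal.coe_mul, NNReal.coe_mk, Real.coe_toNNReal _ (sq_nonneg _), Complex.ofReal_zero,
    mul_zero, zero_mul, zero_sub, Finset.sum_neg_distrib, Complex.ofReal_mul, Complex.ofReal_pow,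
    NNReal.coe_one, Complex.ofReal_one]
  rw [← Finset.sum_div, ← Finset.sum_mul, hw']

lemma neyman_pearson {Ω : Type*} [MeasurableSpace Ω] (P : Measure Ω) [IsFiniteMeasure P]
    (L : Ω → ENNReal) (t : ENNReal) (H A : Set Ω) (hH : MeasurableSet H)
    (hA : MeasurableSet A) (h1 : ∀ e ∈ H, L e ≤ t) (h2 : ∀ e, e ∉ H → t ≤ L e)
    (hle : P H ≤ P A) : P.withDensity L H ≤ P.withDensity L A := by
  have hP : P (H \ A) ≤ P (A \ H) := by
    rw [← measure_inter_add_sdiff H hA, ← measure_inter_add_sdiff A hH, Set.inter_comm A H] at hle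
    exact (ENNReal.add_le_add_iff_left (measure_ne_top _ _)).1 hle
  rw [← measure_inter_add_sdiff H hA, ← measure_inter_add_sdiff A hH, Set.inter_comm A H]
  gcongr 1
  rw [withDensity_apply _ (hH.diff hA), withDensity_apply _ (hA.diff hH)]
  calc ∫⁻ e in H \ A, L e ∂P ≤ ∫⁻ e in H \ A, t ∂P :=
        setLIntegral_mono measurable_const fun e he => h1 e he.1
    _ = t * P (H \ A) := setLIntegral_const _ _
    _ ≤ t * P (A \ H) := by gcongr
    _ = ∫⁻ e in A \ H, t ∂P := (setLIntegral_const _ _).symm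
    _ ≤ ∫⁻ e in A \ H, L e ∂P := setLIntegral_mono' (hA.diff hH) fun e he => h2 e he.2

lemma map_shift {d : ℕ} (μ σ δ : Fin d → ℝ) (hσ : ∀ i, 0 < σ i) :
    (Measure.pi fun i : Fin d => gaussianReal (μ i) ((σ i ^ 2).toNNReal)).map (fun e => δ + e) =
    (Measure.pi fun i : Fin d => gaussianReal (μ i) ((σ i ^ 2).toNNReal)).withDensity
      (fun e => ENNReal.ofReal (Real.exp
        (∑ i, (δ i * (e i - μ i) / σ i ^ 2 - δ i ^ 2 / σ i ^ 2 / 2)))) := by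
  have h1 := Measure.pi_map_pi (μ := fun i : Fin d => gaussianReal (μ i) ((σ i ^ 2).toNNReal))
    (f := fun i y => δ i + y) (hμ := fun i => by
      rw [gaussianReal_map_const_add]; infer_instance) (fun i => by fun_prop)
  have h2 : (fun e : Fin d → ℝ => δ + e) = fun e i => δ i + e i := rfl
  rw [h2, h1]
  have h3 := fun i => gaussian_shift (μ i) (δ i) (σ i) (hσ i)
  have : ∀ i, IsProbabilityMeasure ((gaussianReal (μ i) ((σ i ^ 2).toNNReal)).withDensity
        (fun e => ENNReal.ofReal
          (Real.exp (δ i * (e - μ i) / σ i ^ 2 - δ i ^ 2 / σ i ^ 2 / 2)))) := by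
    intro i; rw [← h3 i]; infer_instance
  simp_rw [gaussianReal_map_const_add, h3]
  rw [pi_withDensity' (fun i : Fin d => gaussianReal (μ i) ((σ i ^ 2).toNNReal)) _
    (fun i => by fun_prop)]
  congr 1
  ext e
  rw [Real.exp_sum, ENNReal.ofReal_prod_of_nonneg (fun i _ => (Real.exp_pos _).le)]

/-- Ellipsoidal certified region for anisotropic Gaussian smoothing. -/
theorem ellipsoidal_certified_region
    {d : ℕ} {Y : Type*} [Fintype Y] [MeasurableSpace Y] [MeasurableSingletonClass Y]
    (f : (Fin d → ℝ) → Y) (hf : Measurable f)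
    (μ : Fin d → ℝ) (σ : Fin d → ℝ) (hσ : ∀ i, 0 < σ i)
    (noise : Measure (Fin d → ℝ))
    (hnoise : noise = Measure.pi fun i : Fin d => gaussianReal (μ i) ((σ i ^ 2).toNNReal))
    (x : Fin d → ℝ) (cA : Y) (pA pB : ℝ)
    (hpA : pA ∈ Set.Icc (0 : ℝ) 1) (hpB : pB ∈ Set.Icc (0 : ℝ) 1)
    (hA : (noise {e | f (x + e) = cA}).toReal ≥ pA)
    (hAB : pA ≥ pB)
    (hB : ∀ c : Y, c ≠ cA → pB ≥ (noise {e | f (x + e) = c}).toReal)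
    (δ : Fin d → ℝ)
    (hδ : Real.sqrt (∑ i, δ i ^ 2 / σ i ^ 2) ≤ (1 / 2) * (PhiInv pA - PhiInv pB)) :
    ∀ c : Y, c ≠ cA →
      (noise {e | f (x + δ + e) = cA}).toReal ≥
        (noise {e | f (x + δ + e) = c}).toReal := by
  intro c hc
  set A : Set (Fin d → ℝ) := {e | f (x + e) = cA} with hAdef
  set B : Set (Fin d → ℝ) := {e | f (x + e) = c} with hBdef
  have hAm : MeasurableSet A := (hf.comp (measurable_const_add x)) (measurableSet_singleton cA)
  have hBm : MeasurableSet B := (hf.comp (measurable_const_add x)) (measurableSet_singleton c)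
  have hprob : IsProbabilityMeasure noise := by rw [hnoise]; infer_instance
  have hdis : Disjoint A B := by
    rw [Set.disjoint_left]; intro e h1 h2; exact hc (h2.symm.trans h1)
  have hQ := map_shift μ σ δ hσ
  rw [← hnoise] at hQ
  have hshift : ∀ S : Set (Fin d → ℝ), MeasurableSet S →
      noise {e | δ + e ∈ S} = noise.map (fun e => δ + e) S := fun S hS => by
    rw [Measure.map_apply (by fun_prop) hS]; rfl
  have eA : {e | f (x + δ + e) = cA} = {e | δ + e ∈ A} := by
    ext e; simp [hAdef, add_assoc]
  have eB : {e | f (x + δ + e) = c} = {e | δ + e ∈ B} := by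
    ext e; simp [hBdef, add_assoc]
  rw [eA, eB, hshift A hAm, hshift B hBm]
  have hQprob : IsProbabilityMeasure (noise.map (fun e => δ + e)) :=
    Measure.isProbabilityMeasure_map (by fun_prop)
  have hPAB : noise.real A + noise.real B ≤ 1 := by
    rw [← measureReal_union hdis hBm]; exact measureReal_le_one
  change pA ≤ noise.real A at hA
  have hB' : noise.real B ≤ pB := hB c hc
  have hBnn : 0 ≤ noise.real B := measureReal_nonneg
  change (noise.map (fun e => δ + e)).real B ≤ (noise.map (fun e => δ + e)).real A
  -- degenerate case
  by_cases hz : noise.real B = 0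
  · have h0 : noise B = 0 := by
      rwa [measureReal_eq_zero_iff] at hz
    have : (noise.map (fun e => δ + e)) B = 0 := by
      rw [hQ]; exact withDensity_absolutelyContinuous _ _ h0
    rw [Measure.real, this]; simp
  have hBpos : 0 < noise.real B := lt_of_le_of_ne hBnn (Ne.symm hz)
  have hpB0 : 0 < pB := by linarith
  have hpA1 : pA < 1 := by linarith
  have hPhA := Phi_PhiInv (by linarith : 0 < pA) hpA1
  have hPhB := Phi_PhiInv hpB0 (by linarith : pB < 1)
  set a := PhiInv pA
  set b := PhiInv pB
  set s := Real.sqrt (∑ i, δ i ^ 2 / σ i ^ 2) with hs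
  have hsnn : 0 ≤ ∑ i, δ i ^ 2 / σ i ^ 2 :=
    Finset.sum_nonneg fun i _ => by positivity
  have hs2 : s ^ 2 = ∑ i, δ i ^ 2 / σ i ^ 2 := Real.sq_sqrt hsnn
  have hsn : 0 ≤ s := Real.sqrt_nonneg _
  clear_value s
  clear hs
  rcases hsn.eq_or_lt with hs0 | hs0
  · have hδ0 : δ = 0 := by
      rw [← hs0] at hs2
      have := (Finset.sum_eq_zero_iff_of_nonneg (fun i _ => by positivity)).1
        (hs2.symm.trans (by norm_num))
      ext i
      have h := this i (Finset.mem_univ i)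
      have := (hσ i).ne'
      simpa [this] using h
    have : (fun e : Fin d → ℝ => δ + e) = id := by ext; simp [hδ0]
    rw [this, Measure.map_id]
    linarith
  set Z : (Fin d → ℝ) → ℝ := fun e => ∑ i, (δ i / (σ i ^ 2 * s)) * (e i - μ i) with hZ
  have hZm : Measurable Z := by fun_prop
  have hlaw : noise.map Z = gaussianReal 0 1 := by
    rw [hnoise]
    apply law_Z
    have : ∀ i, (δ i / (σ i ^ 2 * s)) ^ 2 * σ i ^ 2 = (δ i ^ 2 / σ i ^ 2) / s ^ 2 := by
      intro i
      have := (hσ i).ne'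
      field_simp
    simp_rw [this]
    rw [← Finset.sum_div, ← hs2, div_self (by positivity)]
  have hHm : ∀ r, MeasurableSet {e | Z e ≤ r} := fun r => hZm measurableSet_Iic
  have hPH : ∀ r, noise.real {e | Z e ≤ r} = Phi r := by
    intro r
    unfold Phi
    rw [← hlaw, Measure.map_apply hZm measurableSet_Iic]; rfl
  have hZδ : ∀ e, Z (δ + e) = Z e + s := by
    intro e
    have h1 : s = ∑ i, δ i / (σ i ^ 2 * s) * δ i := by
      have : ∀ i, δ i / (σ i ^ 2 * s) * δ i = (δ i ^ 2 / σ i ^ 2) / s := by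
        intro i
        have := (hσ i).ne'
        field_simp
      simp_rw [this]
      rw [← Finset.sum_div, ← hs2]
      field_simp
    conv_rhs => rw [h1]
    simp only [hZ, Pi.add_apply]
    rw [← Finset.sum_add_distrib]
    exact Finset.sum_congr rfl fun i _ => by rw [← mul_add]; ring
  have hQH : ∀ r, (noise.map (fun e => δ + e)).real {e | Z e ≤ r} = Phi (r - s) := by
    intro r
    rw [← hPH, Measure.real, ← hshift _ (hHm r)]
    congr 2
    ext e
    simp [hZδ, le_sub_iff_add_le]
  have hdens : ∀ e, ∑ i, (δ i * (e i - μ i) / σ i ^ 2 - δ i ^ 2 / σ i ^ 2 / 2)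
      = s * Z e - s ^ 2 / 2 := by
    intro e
    rw [Finset.sum_sub_distrib, ← Finset.sum_div, ← hs2]
    congr 1
    simp only [hZ]
    rw [Finset.mul_sum]
    refine Finset.sum_congr rfl fun i _ => ?_
    have := (hσ i).ne'
    field_simp
  simp_rw [hdens] at hQ
  have hNP : ∀ r, ∀ S : Set (Fin d → ℝ), MeasurableSet S → Phi r ≤ noise.real S →
      Phi (r - s) ≤ (noise.map (fun e => δ + e)).real S := by
    intro r S hS hle
    rw [← hPH] at hle
    rw [← hQH]
    have hle' : noise {e | Z e ≤ r} ≤ noise S :=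
      (ENNReal.toReal_le_toReal (measure_ne_top _ _) (measure_ne_top _ _)).1 hle
    apply ENNReal.toReal_mono (measure_ne_top _ _)
    rw [hQ]
    refine neyman_pearson noise _ (ENNReal.ofReal (Real.exp (s * r - s ^ 2 / 2))) _ _ (hHm r) hS
      ?_ ?_ hle'
    · intro e he
      have he : Z e ≤ r := he
      gcongr
    · intro e he
      have he : r ≤ Z e := (not_le.1 he).le
      gcongr
  have hA2 := hNP a A hAm (by linarith)
  have hB2 := hNP (-b) Bᶜ hBm.compl (by
    rw [Phi_neg, probReal_compl_eq_one_sub hBm]; linarith)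
  rw [probReal_compl_eq_one_sub hBm, show -b - s = -(b + s) by ring, Phi_neg] at hB2
  have := Phi_mono (show b + s ≤ a - s by linarith)
  linarith
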